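/- arXiv:1807.10763 — 2 statements merged into one kernel-verified Lean document; each statement's English description precedes it below -/
import Mathlib

section
/- For all parameters α, λ, θ, b > 0, if 0 < α < 1 and αθ ≤ 1, then the GPGW hazard rate function h(t) = αλθb · t^(α-1) · (1 + λt^α)^(θ-1) is strictly monotone decreasing on (0, ∞). -/
/-- Factoring `t ^ a` out of the second factor moves all growth into `t ^ (a * th - 1)`. -/
theorem rpow_mul_one_add_rpow_eq {a lam th t : ℝ} (hlam : 0 ≤ lam) (ht : 0 < t) :
    t ^ (a - 1) * (1 + lam * t ^ a) ^ (th - 1) =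
      t ^ (a * th - 1) * (t ^ (-a) + lam) ^ (th - 1) := by
  have hfac : 1 + lam * t ^ a = t ^ a * (t ^ (-a) + lam) := by
    rw [mul_add, ← Real.rpow_add ht, add_neg_cancel, Real.rpow_zero, mul_comm lam]
  rw [hfac, Real.mul_rpow (by positivity) (by positivity), ← Real.rpow_mul ht.le, ← mul_assoc,
    ← Real.rpow_add ht]
  ring_nf

theorem gpgw_hazard_decreasing (a lam th b : ℝ) (ha : 0 < a) (hlam : 0 < lam)
    (hth : 0 < th) (hb : 0 < b) (ha1 : a < 1) (hath : a * th ≤ 1) :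
    StrictAntiOn (fun t : ℝ => a * lam * th * b * t ^ (a - 1) * (1 + lam * t ^ a) ^ (th - 1))
      (Set.Ioi 0) := by
  intro x hx y hy hxy
  have hx : 0 < x := hx
  have hy : 0 < y := hy
  simp only [mul_assoc (a * lam * th * b)]
  refine mul_lt_mul_of_pos_left ?_ (by positivity)
  rcases le_or_gt th 1 with h | h
  · refine mul_lt_mul (Real.rpow_lt_rpow_of_neg hx hxy (by linarith)) ?_ (by positivity)
      (by positivity)
    refine Real.rpow_le_rpow_of_nonpos (by positivity) ?_ (by linarith)
    gcongr
  · rw [rpow_mul_one_add_rpow_eq hlam.le hx, rpow_mul_one_add_rpow_eq hlam.le hy]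
    refine mul_lt_mul' (Real.rpow_le_rpow_of_nonpos hx hxy.le (by linarith)) ?_ (by positivity)
      (by positivity)
    refine Real.rpow_lt_rpow (by positivity) ?_ (by linarith)
    have := Real.rpow_lt_rpow_of_neg hx hxy (neg_lt_zero.mpr ha)
    linarith
end

section
/- For all parameters α, λ, θ, b > 0 with α > 1 and 0 < αθ < 1, the GPGW hazard rate function h(t) = αλθb · t^(α-1) · (1 + λt^α)^(θ-1) is unimodal (inverted bathtub shaped): setting t* = ((α-1)/(λ(1-αθ)))^(1/α), h is strictly increasing on (0, t*] and strictly decreasing on [t*, ∞). -/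
open Real Set

theorem hasDerivAt_gpgw_hazard {a lam th b t : ℝ} (hlam : 0 < lam) (ht : 0 < t) :
    HasDerivAt (fun t : ℝ => a * lam * th * b * t ^ (a - 1) * (1 + lam * t ^ a) ^ (th - 1))
      (a * lam * th * b * t ^ (a - 2) * (1 + lam * t ^ a) ^ (th - 2) *
        ((a - 1) - lam * (1 - a * th) * t ^ a)) t := by
  have hta : 0 < t ^ a := rpow_pos_of_pos ht a
  have hbase : 0 < 1 + lam * t ^ a := by positivity
  have hpow := (hasDerivAt_rpow_const (x := t) (p := a - 1) (Or.inl ht.ne')).const_mul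
    (a * lam * th * b)
  have hcomp := (((hasDerivAt_rpow_const (x := t) (p := a) (Or.inl ht.ne')).const_mul
    lam).const_add 1).rpow_const (p := th - 1) (Or.inl hbase.ne')
  refine (hpow.mul hcomp).congr_deriv ?_
  have h1 : t ^ (a - 1) = t ^ (a - 2) * t := by
    rw [← rpow_add_one ht.ne']; ring_nf
  have h2 : t ^ a = t ^ (a - 1) * t := by
    rw [← rpow_add_one ht.ne']; ring_nf
  have h3 : (1 + lam * t ^ a) ^ (th - 1) =
      (1 + lam * t ^ a) ^ (th - 2) * (1 + lam * t ^ a) := by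
    rw [← rpow_add_one hbase.ne']; ring_nf
  rw [show a - 1 - 1 = a - 2 by ring, show th - 1 - 1 = th - 2 by ring, h3]
  generalize (1 + lam * t ^ a) ^ (th - 2) = y
  rw [h2, h1]
  ring

theorem gpgw_hazard_unimodal (a lam th b : ℝ) (ha0 : 0 < a) (hlam : 0 < lam)
    (hth : 0 < th) (hb : 0 < b) (ha1 : 1 < a) (hath0 : 0 < a * th) (hath : a * th < 1) :
    StrictMonoOn (fun t : ℝ => a * lam * th * b * t ^ (a - 1) * (1 + lam * t ^ a) ^ (th - 1))
      (Set.Ioc 0 (((a - 1) / (lam * (1 - a * th))) ^ (1 / a))) ∧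
    StrictAntiOn (fun t : ℝ => a * lam * th * b * t ^ (a - 1) * (1 + lam * t ^ a) ^ (th - 1))
      (Set.Ici (((a - 1) / (lam * (1 - a * th))) ^ (1 / a))) := by
  have hk : 0 < lam * (1 - a * th) := mul_pos hlam (by linarith)
  have hm : 0 < (a - 1) / (lam * (1 - a * th)) := div_pos (by linarith) hk
  set m := ((a - 1) / (lam * (1 - a * th))) ^ (1 / a) with hm_def
  have hm0 : 0 < m := rpow_pos_of_pos hm _
  have hma : lam * (1 - a * th) * m ^ a = a - 1 := by
    rw [hm_def, ← rpow_mul hm.le, one_div_mul_cancel ha0.ne', rpow_one,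
      mul_div_cancel₀ _ hk.ne']
  have hfac : ∀ t : ℝ, 0 < t →
      0 < a * lam * th * b * t ^ (a - 2) * (1 + lam * t ^ a) ^ (th - 2) := fun t ht => by
    positivity
  constructor
  · refine strictMonoOn_of_deriv_pos (convex_Ioc 0 m)
      (fun t ht => (hasDerivAt_gpgw_hazard hlam ht.1).continuousAt.continuousWithinAt) ?_
    intro t ht
    rw [interior_Ioc] at ht
    rw [(hasDerivAt_gpgw_hazard hlam ht.1).deriv]
    refine mul_pos (hfac t ht.1) ?_
    rw [← hma, ← mul_sub]
    exact mul_pos hk (sub_pos.2 (rpow_lt_rpow ht.1.le ht.2 ha0))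
  · refine strictAntiOn_of_deriv_neg (convex_Ici m)
      (fun t ht => (hasDerivAt_gpgw_hazard hlam
        (hm0.trans_le ht)).continuousAt.continuousWithinAt) ?_
    intro t ht
    rw [interior_Ici] at ht
    have ht0 : 0 < t := hm0.trans ht
    rw [(hasDerivAt_gpgw_hazard hlam ht0).deriv]
    refine mul_neg_of_pos_of_neg (hfac t ht0) ?_
    rw [← hma, ← mul_sub]
    exact mul_neg_of_pos_of_neg hk (sub_neg.2 (rpow_lt_rpow hm0.le ht ha0))
end
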